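/- arXiv:2111.08595 — 3 statements merged into one kernel-verified Lean document; each statement's English description precedes it below -/
import Mathlib

section
/- Entropic uncertainty relation for BB84 measurements: let ρ be an arbitrary density matrix on ℂ^{2^n} (positive semidefinite with trace 1). Let Θ = (Θ₁,…,Θₙ) be uniformly distributed over {0,1}ⁿ (0 denoting the computational basis, 1 the Hadamard basis), and let X = (X₁,…,Xₙ) ∈ {0,1}ⁿ be the outcome of measuring the i-th qubit of ρ in basis Θᵢ for each i; that is, the joint distribution of (X,Θ) is P[X=x, Θ=θ] = 2^{−n} ⟨x_θ| ρ |x_θ⟩, where |x_θ⟩ := ⊗ᵢ H^{θᵢ}|xᵢ⟩ with H the 2×2 Hadamard matrix (1/√2)[[1,1],[1,−1]] and |0⟩,|1⟩ the standard basis of ℂ². Then for any 0 < λ < 1/2, H^{ε}_∞(X|Θ) ≥ (1/2 − 2λ)n, where ε = exp(−λ²n / (32(2 − log₂ λ)²)). -/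
open scoped BigOperators Matrix ComplexOrder

/-- `-log₂ t`, with the convention `-log₂ 0 = +∞`, valued in the extended reals. -/
noncomputable def negLog2 (t : ℝ) : EReal :=
  if t = 0 then ⊤ else ((-Real.logb 2 t : ℝ) : EReal)

/-- Conditional smooth min-entropy `H^ε_∞(X|Y)` on a finite probability space. -/
noncomputable def smoothMinEntropyCond {Ω 𝒳 𝒴 : Type*} [Fintype Ω] [Fintype 𝒳] [Fintype 𝒴]
    [DecidableEq 𝒳] [DecidableEq 𝒴]
    (P : Ω → ℝ) (X : Ω → 𝒳) (Y : Ω → 𝒴) (ε : ℝ) : EReal :=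
  ⨆ E : {E : Finset Ω // 1 - ε ≤ ∑ ω ∈ E, P ω},
    ⨅ p : {p : 𝒳 × 𝒴 // 0 < ∑ ω ∈ Finset.univ.filter (fun ω => Y ω = p.2), P ω},
      negLog2
        ((∑ ω ∈ (E : Finset Ω).filter
            (fun ω => X ω = (p : 𝒳 × 𝒴).1 ∧ Y ω = (p : 𝒳 × 𝒴).2), P ω) /
          (∑ ω ∈ Finset.univ.filter (fun ω => Y ω = (p : 𝒳 × 𝒴).2), P ω))

/-- Entry `(z, x)` of `H^θ`, where `H` is the 2×2 Hadamard matrix and `θ ∈ {0,1}`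
(`false` = identity, `true` = Hadamard); `false` encodes the bit `0`. -/
noncomputable def basisEntry (θ x z : Bool) : ℂ :=
  if θ then ((1 / Real.sqrt 2 : ℝ) : ℂ) * (if z ∧ x then -1 else 1)
  else (if z = x then 1 else 0)

/-- The BB84 basis state `|x_θ⟩ = ⊗ᵢ H^{θᵢ} |xᵢ⟩` on `n` qubits, as a vector indexed by
`Fin n → Bool` (the standard basis of `ℂ^{2^n}`). -/
noncomputable def bb84Vec {n : ℕ} (θ x : Fin n → Bool) : (Fin n → Bool) → ℂ :=
  fun z => ∏ i, basisEntry (θ i) (x i) (z i)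

/-- The joint probability `P[X = x, Θ = θ] = 2^{-n} ⟨x_θ| ρ |x_θ⟩` of the basis choice `θ`
and measurement outcome `x` when measuring each qubit `i` of `ρ` in basis `θᵢ`. -/
noncomputable def bb84Prob {n : ℕ} (ρ : Matrix (Fin n → Bool) (Fin n → Bool) ℂ)
    (x θ : Fin n → Bool) : ℝ :=
  (2 : ℝ) ^ (-(n : ℝ)) * ((star (bb84Vec θ x)) ⬝ᵥ (ρ *ᵥ bb84Vec θ x)).re

open MeasureTheory in
/-- The rational inequality behind the chord bound. -/
lemma rat_ineq (p q t : ℝ) (hp : 0 ≤ p) (hq : 0 ≤ q) (h : p + q = 1) (ht : 0 < t) :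
    4*p*q*(t+1/2)⁻¹ + (1-4*p*q)*(t+1)⁻¹ ≤ p*(t+p)⁻¹+q*(t+q)⁻¹ := by
  obtain rfl : q = 1 - p := by linarith
  have h1 : 0 < t + p := by linarith
  have h2 : 0 < t + (1-p) := by linarith
  have h3 : 0 ≤ p*(1-p) := mul_nonneg hp hq
  have key : p*(t+p)⁻¹+(1-p)*(t+(1-p))⁻¹ - (4*p*(1-p)*(t+1/2)⁻¹ + (1-4*p*(1-p))*(t+1)⁻¹)
     = p*(1-p)*(1-2*p)^2 * t /((t+p)*(t+(1-p))*(2*t+1)*(t+1)) * (1/t) := by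
    field_simp
    ring
  have : 0 ≤ p*(1-p)*(1-2*p)^2 * t /((t+p)*(t+(1-p))*(2*t+1)*(t+1)) * (1/t) := by positivity
  linarith

open MeasureTheory in
/-- Chord bound: `p^{1+s} + q^{1+s} ≤ 4pq 2^{-s} + (1-4pq)` for `p+q=1`, `0<s<1`. -/
lemma chord (p q s : ℝ) (hp : 0 ≤ p) (hq : 0 ≤ q) (h : p + q = 1) (hs : s ∈ Set.Ioo (0:ℝ) 1) :
    p * p ^ s + q * q ^ s ≤ 4*p*q*(1/2:ℝ)^s + (1-4*p*q) := by
  obtain ⟨μ, hμ⟩ := Real.exists_measure_rpow_eq_integral_rpowIntegrand₀₁ hs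
  obtain ⟨i1, e1⟩ := hμ p hp
  obtain ⟨i2, e2⟩ := hμ q hq
  obtain ⟨i3, e3⟩ := hμ (1/2) (by simp)
  obtain ⟨i4, e4⟩ := hμ 1 (by simp)
  have e5 : (1-4*p*q) = (1-4*p*q) * (1:ℝ)^s := by simp
  rw [e5, e1, e2, e3, e4, ← integral_const_mul, ← integral_const_mul, ← integral_const_mul,
    ← integral_const_mul, ← integral_add (i1.const_mul p) (i2.const_mul q),
    ← integral_add (i3.const_mul _) (i4.const_mul _)]
  refine setIntegral_mono_on ((i1.const_mul p).add (i2.const_mul q))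
    ((i3.const_mul _).add (i4.const_mul _)) measurableSet_Ioi ?_
  intro t ht
  have ht : 0 < t := ht
  have hr := rat_ineq p q t hp hq h ht
  have hts : 0 ≤ t ^ s := by positivity
  simp only [Real.rpowIntegrand₀₁]
  have := mul_le_mul_of_nonneg_left hr hts
  obtain rfl : q = 1 - p := by linarith
  nlinarith [this]

lemma chord' (x y s : ℝ) (hx : 0 ≤ x) (hy : 0 ≤ y) (hT : 0 < x + y) (hs : s ∈ Set.Ioo (0:ℝ) 1) :
    x ^ (1+s) + y ^ (1+s) ≤
      (x+y)^(1+s) * (4*x*y/(x+y)^2*(1/2:ℝ)^s + (1-4*x*y/(x+y)^2)) := by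
  have h := chord (x/(x+y)) (y/(x+y)) s (by positivity) (by positivity) (by field_simp) hs
  have hs1 : 0 < s := hs.1
  have ex : ∀ z : ℝ, 0 ≤ z → z ^ (1+s) = (x+y)^(1+s) * (z/(x+y) * (z/(x+y))^s) := by
    intro z hz
    have hz' : 0 ≤ z / (x+y) := by positivity
    have : z/(x+y) * (z/(x+y))^s = (z/(x+y))^(1+s) := by
      rw [Real.rpow_add_of_nonneg hz' zero_le_one hs1.le, Real.rpow_one]
    rw [this, ← Real.mul_rpow hT.le hz']
    congr 1
    field_simp
  rw [ex x hx, ex y hy, ← mul_add]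
  refine mul_le_mul_of_nonneg_left (h.trans (le_of_eq ?_)) (by positivity)
  field_simp

/-- Single qubit inequality. -/
lemma single (a d c s : ℝ) (ha : 0 ≤ a) (hd : 0 ≤ d) (hc : c^2 ≤ a*d) (hs : s ∈ Set.Ioo (0:ℝ) 1) :
    a^(1+s) + d^(1+s) + (((a+d)/2+c)^(1+s) + ((a+d)/2-c)^(1+s)) ≤
      (1 + (1/2:ℝ)^s) * (a+d)^(1+s) := by
  have hs1 : 0 < s := hs.1
  rcases (add_nonneg ha hd).eq_or_lt with h0 | hT
  · have ha0 : a = 0 := by linarith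
    have hd0 : d = 0 := by linarith
    subst ha0 hd0
    have hc0 : c = 0 := by nlinarith
    subst hc0
    have : (0:ℝ)^(1+s) = 0 := Real.zero_rpow (by linarith)
    simp [this]
  · have hc' : c^2 ≤ ((a+d)/2)^2 := by nlinarith [sq_nonneg (a-d)]
    obtain ⟨h1, h2⟩ := abs_le.1 (abs_le_of_sq_le_sq hc' (by positivity))
    have k1 := chord' a d s ha hd hT hs
    have e : ((a+d)/2+c) + ((a+d)/2-c) = a+d := by ring
    have k2 := chord' ((a+d)/2+c) ((a+d)/2-c) s (by linarith) (by linarith) (by rw [e]; exact hT) hs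
    rw [e] at k2
    refine (add_le_add k1 k2).trans ?_
    rw [← mul_add, mul_comm _ ((a+d)^(1+s))]
    refine mul_le_mul_of_nonneg_left ?_ (by positivity)
    have hh : (1/2:ℝ)^s ≤ 1 := Real.rpow_le_one (by norm_num) (by norm_num) hs1.le
    have e2 : 4*((a+d)/2+c)*((a+d)/2-c)/(a+d)^2 = 1 - 4*c^2/(a+d)^2 := by
      field_simp; ring
    rw [e2]
    have e3 : 4*c^2/(a+d)^2 ≤ 4*a*d/(a+d)^2 := by
      apply div_le_div_of_nonneg_right _ (by positivity); linarith
    nlinarith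

open scoped MatrixOrder in
lemma psd_factor {m : Type*} [Fintype m] [DecidableEq m] (A : Matrix m m ℂ) (hA : A.PosSemidef) :
    ∃ B : Matrix m m ℂ, A = Bᴴ * B :=
  CStarAlgebra.nonneg_iff_eq_star_mul_self.1 hA.nonneg

/-- Squared amplitude weight of a family of vectors. -/
noncomputable def wt {K : Type*} [Fintype K] {n : ℕ} (ψ : K → (Fin n → Bool) → ℂ)
    (θ x : Fin n → Bool) : ℝ :=
  ∑ k, Complex.normSq (∑ z, ψ k z * bb84Vec θ x z)

noncomputable def tot {K : Type*} [Fintype K] {n : ℕ} (ψ : K → (Fin n → Bool) → ℂ) : ℝ :=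
  ∑ k, ∑ z, Complex.normSq (ψ k z)

noncomputable def peel {K : Type*} {n : ℕ} (ψ : K → (Fin (n+1) → Bool) → ℂ)
    (t b : Bool) : K → (Fin n → Bool) → ℂ :=
  fun k z => ∑ c : Bool, ψ k (Fin.cons c z) * basisEntry t b c

lemma sum_cons {M : Type*} [AddCommMonoid M] {n : ℕ} (f : (Fin (n+1) → Bool) → M) :
    ∑ z, f z = ∑ c : Bool, ∑ z : Fin n → Bool, f (Fin.cons c z) := by
  rw [← Fintype.sum_prod_type', ← (Fin.consEquiv (fun _ : Fin (n+1) => Bool)).sum_comp]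
  rfl

lemma wt_nonneg {K : Type*} [Fintype K] {n : ℕ} (ψ : K → (Fin n → Bool) → ℂ)
    (θ x : Fin n → Bool) : 0 ≤ wt ψ θ x :=
  Finset.sum_nonneg fun _ _ => Complex.normSq_nonneg _

lemma wt_cons {K : Type*} [Fintype K] {n : ℕ} (ψ : K → (Fin (n+1) → Bool) → ℂ)
    (t b : Bool) (θ x : Fin n → Bool) :
    wt ψ (Fin.cons t θ) (Fin.cons b x) = wt (peel ψ t b) θ x := by
  unfold wt
  refine Finset.sum_congr rfl fun k _ => ?_
  congr 1
  rw [sum_cons, Finset.sum_comm]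
  refine Finset.sum_congr rfl fun z _ => ?_
  simp only [peel, bb84Vec, Fin.prod_univ_succ, Fin.cons_zero, Fin.cons_succ, Finset.sum_mul]
  refine Finset.sum_congr rfl fun c _ => ?_
  ring

/-- The reduced one-qubit data. -/
lemma tot_peel {K : Type*} [Fintype K] {n : ℕ} (ψ : K → (Fin (n+1) → Bool) → ℂ) :
    ∃ a d c : ℝ, 0 ≤ a ∧ 0 ≤ d ∧ c^2 ≤ a*d ∧ tot ψ = a + d ∧
      tot (peel ψ false false) = a ∧ tot (peel ψ false true) = d ∧
      tot (peel ψ true false) = (a+d)/2 + c ∧ tot (peel ψ true true) = (a+d)/2 - c := by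
  have h2 : Complex.normSq ((1 / Real.sqrt 2 : ℝ) : ℂ) = 1/2 := by
    rw [Complex.normSq_ofReal]
    rw [div_mul_div_comm, Real.mul_self_sqrt (by norm_num)]; norm_num
  refine ⟨∑ p : K × (Fin n → Bool), Complex.normSq (ψ p.1 (Fin.cons false p.2)),
    ∑ p : K × (Fin n → Bool), Complex.normSq (ψ p.1 (Fin.cons true p.2)),
    ∑ p : K × (Fin n → Bool),
      (ψ p.1 (Fin.cons false p.2) * star (ψ p.1 (Fin.cons true p.2))).re,
    Finset.sum_nonneg fun _ _ => Complex.normSq_nonneg _,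
    Finset.sum_nonneg fun _ _ => Complex.normSq_nonneg _, ?_, ?_, ?_, ?_, ?_, ?_⟩
  · have hb : |∑ p : K × (Fin n → Bool),
        (ψ p.1 (Fin.cons false p.2) * star (ψ p.1 (Fin.cons true p.2))).re| ≤
        ∑ p : K × (Fin n → Bool),
          ‖ψ p.1 (Fin.cons false p.2)‖ * ‖ψ p.1 (Fin.cons true p.2)‖ := by
      refine (Finset.abs_sum_le_sum_abs _ _).trans (Finset.sum_le_sum fun p _ => ?_)
      refine (Complex.abs_re_le_norm _).trans (le_of_eq ?_)
      rw [norm_mul, norm_star]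
    have hcs := Finset.sum_mul_sq_le_sq_mul_sq (Finset.univ : Finset (K × (Fin n → Bool)))
      (fun p => ‖ψ p.1 (Fin.cons false p.2)‖) (fun p => ‖ψ p.1 (Fin.cons true p.2)‖)
    simp only [Complex.normSq_eq_norm_sq]
    refine le_trans ?_ hcs
    rw [← sq_abs]
    exact pow_le_pow_left₀ (abs_nonneg _) hb 2
  · simp only [tot, sum_cons, Fintype.sum_bool, Fintype.sum_prod_type, Finset.sum_add_distrib]
    ring
  · simp [tot, peel, basisEntry, Fintype.sum_prod_type]
  · simp [tot, peel, basisEntry, Fintype.sum_prod_type]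
  · rw [tot, ← Fintype.sum_prod_type', ← Finset.sum_add_distrib, Finset.sum_div,
      ← Finset.sum_add_distrib]
    refine Finset.sum_congr rfl fun p _ => ?_
    have : peel ψ true false p.1 p.2 = ((1 / Real.sqrt 2 : ℝ) : ℂ) *
        (ψ p.1 (Fin.cons false p.2) + ψ p.1 (Fin.cons true p.2)) := by
      simp only [peel, basisEntry, Fintype.sum_bool]; simp; ring
    rw [this, Complex.normSq_mul, h2, Complex.normSq_add]
    simp only [starRingEnd_apply]; ring
  · rw [tot, ← Fintype.sum_prod_type', ← Finset.sum_add_distrib, Finset.sum_div,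
      ← Finset.sum_sub_distrib]
    refine Finset.sum_congr rfl fun p _ => ?_
    have : peel ψ true true p.1 p.2 = ((1 / Real.sqrt 2 : ℝ) : ℂ) *
        (ψ p.1 (Fin.cons false p.2) - ψ p.1 (Fin.cons true p.2)) := by
      simp only [peel, basisEntry, Fintype.sum_bool]; simp; ring
    rw [this, Complex.normSq_mul, h2, Complex.normSq_sub]
    simp only [starRingEnd_apply]; ring

lemma sum_wt {K : Type*} [Fintype K] : ∀ {n : ℕ} (ψ : K → (Fin n → Bool) → ℂ)
    (θ : Fin n → Bool), ∑ x, wt ψ θ x = tot ψ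
  | 0, ψ, θ => by simp [wt, tot, bb84Vec]
  | n+1, ψ, θ => by
    obtain ⟨a, d, c, -, -, -, h, h1, h2, h3, h4⟩ := tot_peel ψ
    rw [sum_cons, ← Fin.cons_self_tail θ]
    simp only [wt_cons, sum_wt, Fintype.sum_bool]
    cases θ 0
    · rw [h, h1, h2]; ring
    · rw [h, h3, h4]; ring

lemma moment {K : Type*} [Fintype K] (s : ℝ) (hs : s ∈ Set.Ioo (0:ℝ) 1) :
    ∀ {n : ℕ} (ψ : K → (Fin n → Bool) → ℂ),
    ∑ θ, ∑ x, wt ψ θ x ^ (1+s) ≤ (1 + (1/2:ℝ)^s)^n * tot ψ ^ (1+s)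
  | 0, ψ => by simp [wt, tot, bb84Vec]
  | n+1, ψ => by
    obtain ⟨a, d, c, ha, hd, hc, h, h1, h2, h3, h4⟩ := tot_peel ψ
    have hsing := single a d c s ha hd hc hs
    have e : ∑ θ, ∑ x, wt ψ θ x ^ (1+s) =
        ∑ t : Bool, ∑ b : Bool, ∑ θ, ∑ x, wt (peel ψ t b) θ x ^ (1+s) := by
      rw [sum_cons]
      refine Finset.sum_congr rfl fun t _ => ?_
      refine Eq.trans ?_ Finset.sum_comm
      refine Finset.sum_congr rfl fun θ _ => ?_
      rw [sum_cons]
      simp only [wt_cons]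
    rw [e]
    calc _ ≤ ∑ t : Bool, ∑ b : Bool, (1 + (1/2:ℝ)^s)^n * tot (peel ψ t b) ^ (1+s) :=
          Finset.sum_le_sum fun t _ => Finset.sum_le_sum fun b _ => moment s hs _
      _ = (1 + (1/2:ℝ)^s)^n * (a^(1+s) + d^(1+s) +
            (((a+d)/2+c)^(1+s) + ((a+d)/2-c)^(1+s))) := by
          simp only [Fintype.sum_bool, h1, h2, h3, h4]; ring
      _ ≤ (1 + (1/2:ℝ)^s)^n * ((1 + (1/2:ℝ)^s) * (a+d)^(1+s)) :=
          mul_le_mul_of_nonneg_left hsing (by positivity)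
      _ = _ := by rw [h]; ring

/-- The numerical estimate. -/
lemma numeric (n : ℕ) (lam : ℝ) (hlam0 : 0 < lam) (hlam : lam < 1 / 2) :
    (2:ℝ) ^ (-(n:ℝ)) * (1 + (1/2:ℝ)^lam)^n * ((2:ℝ) ^ (-((1/2 - 2*lam)*n))) ^ (-lam) ≤
      Real.exp (-(lam ^ 2 * n) / (32 * (2 - Real.logb 2 lam) ^ 2)) := by
  set L := Real.log 2 with hL
  have hL1 : 0.6931471803 < L := Real.log_two_gt_d9
  have hL2 : L < 0.6931471808 := Real.log_two_lt_d9
  have e1 : (2:ℝ) ^ (-(n:ℝ)) = (Real.exp (-L))^n := by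
    rw [← Real.exp_nat_mul, Real.rpow_def_of_pos (by norm_num)]; congr 1; ring
  have e2 : ((2:ℝ) ^ (-((1/2 - 2*lam)*n))) ^ (-lam) = (Real.exp (L*(1/2-2*lam)*lam))^n := by
    rw [← Real.exp_nat_mul, ← Real.rpow_mul (by norm_num), Real.rpow_def_of_pos (by norm_num)]
    congr 1; ring
  have e3 : (1/2:ℝ)^lam = Real.exp (-L*lam) := by
    rw [Real.rpow_def_of_pos (by norm_num)]
    congr 1; rw [one_div, Real.log_inv]
  rw [e1, e2, e3, ← mul_pow, ← mul_pow]
  have e4 : Real.exp (-L) = 1/2 := by rw [Real.exp_neg, Real.exp_log (by norm_num)]; norm_num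
  have e5 : Real.exp (-L) * (1 + Real.exp (-L*lam)) * Real.exp (L*(1/2-2*lam)*lam)
      = Real.cosh (L*lam/2) * Real.exp (-2*L*lam^2) := by
    rw [e4, Real.cosh_eq, mul_assoc, add_mul, one_mul, ← Real.exp_add]
    rw [div_mul_eq_mul_div _ 2 (Real.exp (-2*L*lam^2)), add_mul, ← Real.exp_add, ← Real.exp_add]
    have a1 : -L*lam + L*(1/2-2*lam)*lam = -(L*lam/2) + -2*L*lam^2 := by ring
    have a2 : L*(1/2-2*lam)*lam = L*lam/2 + -2*L*lam^2 := by ring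
    rw [a1, a2]; ring
  rw [e5]
  have e6 : Real.cosh (L*lam/2) * Real.exp (-2*L*lam^2) ≤ Real.exp (-lam^2) := by
    refine (mul_le_mul_of_nonneg_right (Real.cosh_le_exp_half_sq _) (Real.exp_pos _).le).trans ?_
    rw [← Real.exp_add]
    apply Real.exp_le_exp.2
    have : L^2/8 - 2*L ≤ -1 := by nlinarith
    nlinarith [mul_le_mul_of_nonneg_right this (sq_nonneg lam)]
  refine (pow_le_pow_left₀ (by have := Real.cosh_pos (L*lam/2); positivity) e6 n).trans ?_
  rw [← Real.exp_nat_mul]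
  apply Real.exp_le_exp.2
  have hlog : Real.logb 2 lam < 0 := Real.logb_neg (by norm_num) hlam0 (by linarith)
  have hD : 1 ≤ 32 * (2 - Real.logb 2 lam) ^ 2 := by nlinarith
  rw [neg_div]
  have : lam^2*n / (32 * (2 - Real.logb 2 lam) ^ 2) ≤ lam^2*n :=
    div_le_self (by positivity) hD
  linarith

/-- Entropic uncertainty relation: if `ρ` is an arbitrary `n`-qubit density matrix, `Θ` is
uniform over the `2ⁿ` BB84 basis choices, and `X` is the outcome of measuring `ρ` in basis
`Θ`, then for any `0 < λ < 1/2`, `H^ε_∞(X|Θ) ≥ (1/2 - 2λ) n` where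
`ε = exp(-λ²n / (32 (2 - log₂ λ)²))`. -/
theorem entropic_uncertainty_bb84 {n : ℕ}
    (ρ : Matrix (Fin n → Bool) (Fin n → Bool) ℂ)
    (hρ : ρ.PosSemidef) (hρtr : ρ.trace = 1)
    (lam : ℝ) (hlam0 : 0 < lam) (hlam : lam < 1 / 2) :
    (((1 / 2 - 2 * lam) * n : ℝ) : EReal)
      ≤ smoothMinEntropyCond
          (fun p : (Fin n → Bool) × (Fin n → Bool) => bb84Prob ρ p.1 p.2)
          Prod.fst Prod.snd
          (Real.exp (-(lam ^ 2 * n) / (32 * (2 - Real.logb 2 lam) ^ 2))) := by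
  obtain ⟨B, rfl⟩ := psd_factor ρ hρ
  obtain ⟨ψ, hψ⟩ : ∃ ψ : (Fin n → Bool) → (Fin n → Bool) → ℂ, ∀ k z, B k z = ψ k z :=
    ⟨fun k z => B k z, fun _ _ => rfl⟩
  have htot : tot ψ = 1 := by
    have h := congrArg Complex.re hρtr
    simp only [Matrix.trace, Matrix.diag, Matrix.mul_apply, Matrix.conjTranspose_apply,
      Complex.one_re, Complex.re_sum] at h
    rw [Finset.sum_comm] at h
    rw [← h, tot]
    refine Finset.sum_congr rfl fun k _ => Finset.sum_congr rfl fun z _ => ?_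
    simp [Complex.normSq_apply, hψ]
  have hP : ∀ x θ, bb84Prob (Bᴴ * B) x θ = (2:ℝ) ^ (-(n:ℝ)) * wt ψ θ x := by
    intro x θ
    rw [bb84Prob, ← Matrix.mulVec_mulVec, Matrix.dotProduct_mulVec, Matrix.vecMul_conjTranspose,
      star_star]
    congr 1
    simp only [dotProduct, Complex.re_sum, wt]
    refine Finset.sum_congr rfl fun k _ => ?_
    have e : (B *ᵥ bb84Vec θ x) k = ∑ z, ψ k z * bb84Vec θ x z := by
      simp only [Matrix.mulVec, dotProduct, hψ]
    rw [Pi.star_apply, e, Complex.normSq_apply]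
    simp only [Complex.mul_re, Complex.star_def, Complex.conj_re, Complex.conj_im]
    ring
  set T : ℝ := (2:ℝ) ^ (-((1/2 - 2*lam)*n)) with hTdef
  have hT : 0 < T := by positivity
  set N : ℝ := (2:ℝ) ^ (-(n:ℝ)) with hN
  have hN0 : 0 < N := by positivity
  have hmarg : ∀ θ : Fin n → Bool,
      ∑ ω ∈ Finset.univ.filter (fun ω : (Fin n → Bool) × (Fin n → Bool) => ω.2 = θ),
        bb84Prob (Bᴴ * B) ω.1 ω.2 = N := by
    intro θ
    rw [Finset.sum_filter, Fintype.sum_prod_type]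
    simp only [Finset.sum_ite_eq', Finset.mem_univ, if_true, hP]
    rw [← Finset.mul_sum, sum_wt, htot, mul_one]
  have htotal : ∑ ω : (Fin n → Bool) × (Fin n → Bool), bb84Prob (Bᴴ * B) ω.1 ω.2 = 1 := by
    rw [Fintype.sum_prod_type_right]
    simp only [hP]
    simp only [← Finset.mul_sum, sum_wt, htot]
    rw [hN, Real.rpow_neg (by norm_num), Real.rpow_natCast]
    simp
  let E : Finset ((Fin n → Bool) × (Fin n → Bool)) :=
    Finset.univ.filter (fun ω => wt ψ ω.2 ω.1 ≤ T)
  have hE : 1 - (Real.exp (-(lam ^ 2 * n) / (32 * (2 - Real.logb 2 lam) ^ 2))) ≤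
      ∑ ω ∈ E, bb84Prob (Bᴴ * B) ω.1 ω.2 := by
    rw [← htotal, ← Finset.sum_filter_add_sum_filter_not Finset.univ
      (fun ω : (Fin n → Bool) × (Fin n → Bool) => wt ψ ω.2 ω.1 ≤ T)]
    suffices h : ∑ ω ∈ Finset.univ.filter
        (fun ω : (Fin n → Bool) × (Fin n → Bool) => ¬ wt ψ ω.2 ω.1 ≤ T),
        bb84Prob (Bᴴ * B) ω.1 ω.2 ≤
        Real.exp (-(lam ^ 2 * n) / (32 * (2 - Real.logb 2 lam) ^ 2)) by
      simp only [E]; linarith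
    refine le_trans ?_ (numeric n lam hlam0 hlam)
    have hm := moment lam ⟨hlam0, by linarith⟩ ψ
    rw [htot, Real.one_rpow, mul_one] at hm
    calc _ ≤ ∑ ω ∈ Finset.univ.filter
            (fun ω : (Fin n → Bool) × (Fin n → Bool) => ¬ wt ψ ω.2 ω.1 ≤ T),
            N * (wt ψ ω.2 ω.1 ^ (1+lam)) * T ^ (-lam) := by
          refine Finset.sum_le_sum fun ω hω => ?_
          have hw : T < wt ψ ω.2 ω.1 := by simpa using hω
          have hw0 : 0 < wt ψ ω.2 ω.1 := hT.trans hw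
          rw [hP, Real.rpow_add hw0, Real.rpow_one, Real.rpow_neg hT.le]
          have : 1 ≤ wt ψ ω.2 ω.1 ^ lam * (T ^ lam)⁻¹ := by
            rw [← div_eq_mul_inv, one_le_div (by positivity)]
            exact Real.rpow_le_rpow hT.le hw.le hlam0.le
          have h2 := mul_le_mul_of_nonneg_left this (mul_pos hN0 hw0).le
          nlinarith [h2]
      _ ≤ ∑ ω : (Fin n → Bool) × (Fin n → Bool),
            N * (wt ψ ω.2 ω.1 ^ (1+lam)) * T ^ (-lam) := by
          refine Finset.sum_le_sum_of_subset_of_nonneg (Finset.filter_subset _ _) fun ω _ _ => ?_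
          have := wt_nonneg ψ ω.2 ω.1
          positivity
      _ = N * (∑ θ, ∑ x, wt ψ θ x ^ (1+lam)) * T ^ (-lam) := by
          rw [← Finset.sum_mul, ← Finset.mul_sum, Fintype.sum_prod_type_right]
      _ ≤ _ := by gcongr
  unfold smoothMinEntropyCond
  refine le_iSup_of_le ⟨E, hE⟩ ?_
  refine le_iInf fun p => ?_
  obtain ⟨⟨x, θ⟩, hp⟩ := p
  simp only [hmarg]
  have hsum : ∑ ω ∈ E.filter (fun ω => ω.1 = x ∧ ω.2 = θ), bb84Prob (Bᴴ * B) ω.1 ω.2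
      = if wt ψ θ x ≤ T then N * wt ψ θ x else 0 := by
    have : E.filter (fun ω => ω.1 = x ∧ ω.2 = θ) = if wt ψ θ x ≤ T then {(x, θ)} else ∅ := by
      ext ⟨y, η⟩
      split_ifs with h
      · simp only [E, Finset.mem_filter, Finset.mem_univ, true_and, Finset.mem_singleton,
          Prod.mk.injEq]
        constructor
        · exact fun h => h.2
        · rintro ⟨rfl, rfl⟩; exact ⟨h, rfl, rfl⟩
      · simp only [E, Finset.mem_filter, Finset.mem_univ, true_and, Finset.notMem_empty,
          iff_false]
        rintro ⟨h1, rfl, rfl⟩; exact h h1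
    rw [this]
    split_ifs
    · simp [hP]
    · simp
  rw [hsum]
  unfold negLog2
  split_ifs with h1 h2 h2
  · exact le_top
  · rw [mul_div_cancel_left₀ _ hN0.ne'] at h2 ⊢
    rw [EReal.coe_le_coe_iff]
    have hw0 : 0 < wt ψ θ x := lt_of_le_of_ne (wt_nonneg _ _ _) (Ne.symm h2)
    have := Real.logb_le_logb_of_le (by norm_num : (1:ℝ) < 2) hw0 h1
    rw [hTdef, Real.logb_rpow (by norm_num) (by norm_num)] at this
    linarith
  · exact le_top
  · simp at h2
end

section
/- Min-entropy splitting: let ε ≥ 0, and let X₀, X₁, Z be random variables taking values in finite sets such that H^{ε}_∞(X₀X₁|Z) ≥ α, where H^{ε}_∞(X₀X₁|Z) is the conditional smooth min-entropy of the joint variable (X₀,X₁) given Z. Then there exists a binary random variable C with values in {0,1}, defined on an extension of the underlying probability space, such that for every ε' > 0, H^{ε+ε'}_∞(X_{1−C} | Z C) ≥ α/2 − 1 − log₂(1/ε'), where the conditioning is on the pair (Z,C). -/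
open scoped BigOperators

lemma le_negLog2_iff (β r : ℝ) (hr : 0 ≤ r) :
    ((β : ℝ) : EReal) ≤ negLog2 r ↔ r ≤ (2 : ℝ) ^ (-β) := by
  unfold negLog2
  split_ifs with h
  · subst h
    simp only [le_top, true_iff]
    positivity
  · have hr' : 0 < r := lt_of_le_of_ne hr (Ne.symm h)
    rw [EReal.coe_le_coe_iff, ← Real.logb_le_iff_le_rpow (by norm_num) hr']
    constructor <;> intro h <;> linarith

lemma sum_ext_bool {Ω : Type*} [Fintype Ω] [DecidableEq Ω] (P : Ω → ℝ) (C : Ω → Bool)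
    (S : Finset (Ω × Bool)) :
    ∑ p ∈ S, (if p.2 = C p.1 then P p.1 else 0)
      = ∑ ω ∈ Finset.univ.filter (fun ω => (ω, C ω) ∈ S), P ω := by
  rw [← Finset.sum_filter]
  symm
  refine Finset.sum_bij (fun ω _ => (ω, C ω)) ?_ ?_ ?_ ?_
  · intro a ha; simpa using ha
  · intro a _ b _ h; exact (Prod.ext_iff.mp h).1
  · rintro ⟨a, c⟩ h
    simp only [Finset.mem_filter] at h
    obtain ⟨h1, h2⟩ := h
    subst h2
    exact ⟨a, by simpa using h1, rfl⟩
  · intros; rfl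

/-- The bad set has small mass. -/
lemma bad_mass {Ω 𝒵 : Type*} [Fintype Ω] [Fintype 𝒵] [DecidableEq 𝒵]
    (P : Ω → ℝ) (hP : ∀ ω, 0 ≤ P ω) (hPsum : ∑ ω, P ω = 1)
    (Z : Ω → 𝒵) (C : Ω → Bool) (δ : ℝ) (hδ : 0 < δ) :
    ∑ ω ∈ Finset.univ.filter (fun ω =>
        ∑ ω' ∈ Finset.univ.filter (fun ω' => Z ω' = Z ω ∧ C ω' = C ω), P ω'
          < δ / 2 * ∑ ω' ∈ Finset.univ.filter (fun ω' => Z ω' = Z ω), P ω'), P ω ≤ δ := by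
  rw [← Finset.sum_fiberwise (g := fun ω => (Z ω, C ω))]
  have hb : ∀ zc : 𝒵 × Bool, ∑ ω ∈ (Finset.univ.filter (fun ω =>
        ∑ ω' ∈ Finset.univ.filter (fun ω' => Z ω' = Z ω ∧ C ω' = C ω), P ω'
          < δ / 2 * ∑ ω' ∈ Finset.univ.filter (fun ω' => Z ω' = Z ω), P ω')).filter
            (fun ω => (Z ω, C ω) = zc), P ω
      ≤ δ / 2 * ∑ ω' ∈ Finset.univ.filter (fun ω' => Z ω' = zc.1), P ω' := by
    rintro ⟨z, c⟩
    by_cases h : ∑ ω' ∈ Finset.univ.filter (fun ω' => Z ω' = z ∧ C ω' = c), P ω'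
          < δ / 2 * ∑ ω' ∈ Finset.univ.filter (fun ω' => Z ω' = z), P ω'
    · refine le_trans (Finset.sum_le_sum_of_subset_of_nonneg ?_ (fun i _ _ => hP i)) h.le
      intro ω hω
      simp only [Finset.mem_filter, Finset.mem_univ, true_and, Prod.mk.injEq] at hω ⊢
      exact hω.2
    · rw [Finset.sum_eq_zero]
      · exact mul_nonneg (by linarith) (Finset.sum_nonneg fun i _ => hP i)
      · intro ω hω
        exfalso
        simp only [Finset.mem_filter, Finset.mem_univ, true_and, Prod.mk.injEq] at hω
        obtain ⟨h1, rfl, rfl⟩ := hω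
        exact h h1
  refine (Finset.sum_le_sum fun zc _ => hb zc).trans ?_
  rw [Fintype.sum_prod_type]
  have := Finset.sum_fiberwise (s := Finset.univ) (g := Z) (f := P)
  simp only [Fintype.sum_bool]
  rw [Finset.sum_add_distrib, ← Finset.mul_sum, this, hPsum]
  linarith

/-- The splitting bound for `X₀` on the heavy part. -/
lemma heavy_bound {Ω 𝒳₀ 𝒳₁ 𝒵 : Type*} [Fintype 𝒳₁]
    [DecidableEq 𝒳₀] [DecidableEq 𝒳₁] [DecidableEq 𝒵]
    (P : Ω → ℝ) (hP : ∀ ω, 0 ≤ P ω) (X₀ : Ω → 𝒳₀) (X₁ : Ω → 𝒳₁) (Z : Ω → 𝒵)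
    (E : Finset Ω) (t D : ℝ) (ht : 0 < t) (z : 𝒵) (x₀ : 𝒳₀)
    (hD : 0 < D) (hDE : ∑ ω ∈ E.filter (fun ω => Z ω = z), P ω ≤ D)
    (hE : ∀ x₁, ∑ ω ∈ E.filter (fun ω => (X₀ ω, X₁ ω) = (x₀, x₁) ∧ Z ω = z), P ω ≤ t * t * D) :
    ∑ ω ∈ E.filter (fun ω => X₀ ω = x₀ ∧ Z ω = z ∧
      t * D ≤ ∑ ω' ∈ E.filter (fun ω' => X₁ ω' = X₁ ω ∧ Z ω' = z), P ω'), P ω ≤ t * D := by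
  set q : 𝒳₁ → ℝ := fun x₁ => ∑ ω' ∈ E.filter (fun ω' => X₁ ω' = x₁ ∧ Z ω' = z), P ω' with hq
  have hq0 : ∀ x, 0 ≤ q x := fun x => Finset.sum_nonneg fun i _ => hP i
  have hqs : ∑ x, q x ≤ D := by
    refine le_trans (le_of_eq ?_) hDE
    rw [← Finset.sum_fiberwise (g := X₁)]
    refine Finset.sum_congr rfl fun x _ => ?_
    rw [Finset.filter_filter]
    refine Finset.sum_congr (Finset.filter_congr fun ω _ => ?_) fun _ _ => rfl
    tauto
  rw [← Finset.sum_fiberwise (g := X₁)]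
  have hb : ∀ x₁ : 𝒳₁, ∑ ω ∈ (E.filter (fun ω => X₀ ω = x₀ ∧ Z ω = z ∧
      t * D ≤ q (X₁ ω))).filter (fun ω => X₁ ω = x₁), P ω ≤ t * q x₁ := by
    intro x₁
    by_cases h : t * D ≤ q x₁
    · calc _ ≤ ∑ ω ∈ E.filter (fun ω => (X₀ ω, X₁ ω) = (x₀, x₁) ∧ Z ω = z), P ω := by
            refine Finset.sum_le_sum_of_subset_of_nonneg ?_ (fun i _ _ => hP i)
            intro ω hω
            simp only [Finset.mem_filter, Prod.mk.injEq] at hω ⊢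
            tauto
        _ ≤ t * t * D := hE x₁
        _ ≤ t * q x₁ := by nlinarith
    · rw [Finset.sum_eq_zero]
      · exact mul_nonneg ht.le (hq0 _)
      · intro ω hω
        exfalso
        simp only [Finset.mem_filter] at hω
        obtain ⟨⟨_, _, _, h1⟩, rfl⟩ := hω
        exact h h1
  refine (Finset.sum_le_sum fun x _ => hb x).trans ?_
  rw [← Finset.mul_sum]
  exact mul_le_mul_of_nonneg_left hqs ht.le

/-- Extract the optimal event. -/
lemma exists_event {Ω 𝒳 𝒴 : Type*} [Fintype Ω] [Fintype 𝒳] [Fintype 𝒴]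
    [DecidableEq 𝒳] [DecidableEq 𝒴]
    (P : Ω → ℝ) (hP : ∀ ω, 0 ≤ P ω) (hPsum : ∑ ω, P ω = 1) (X : Ω → 𝒳) (Y : Ω → 𝒴)
    (ε α : ℝ) (hε : 0 ≤ ε) (hH : ((α : ℝ) : EReal) ≤ smoothMinEntropyCond P X Y ε) :
    ∃ E : Finset Ω, 1 - ε ≤ ∑ ω ∈ E, P ω ∧ ∀ x y,
      0 < ∑ ω ∈ Finset.univ.filter (fun ω => Y ω = y), P ω →
      ∑ ω ∈ E.filter (fun ω => X ω = x ∧ Y ω = y), P ω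
        ≤ (2 : ℝ) ^ (-α) * ∑ ω ∈ Finset.univ.filter (fun ω => Y ω = y), P ω := by
  unfold smoothMinEntropyCond at hH
  haveI : Nonempty {E : Finset Ω // 1 - ε ≤ ∑ ω ∈ E, P ω} :=
    ⟨⟨Finset.univ, by rw [hPsum]; linarith⟩⟩
  obtain ⟨E, hE⟩ := exists_eq_ciSup_of_finite (f := fun E : {E : Finset Ω // 1 - ε ≤ ∑ ω ∈ E, P ω} =>
    ⨅ p : {p : 𝒳 × 𝒴 // 0 < ∑ ω ∈ Finset.univ.filter (fun ω => Y ω = p.2), P ω},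
      negLog2
        ((∑ ω ∈ (E : Finset Ω).filter
            (fun ω => X ω = (p : 𝒳 × 𝒴).1 ∧ Y ω = (p : 𝒳 × 𝒴).2), P ω) /
          (∑ ω ∈ Finset.univ.filter (fun ω => Y ω = (p : 𝒳 × 𝒴).2), P ω)))
  rw [← hE] at hH
  refine ⟨E.1, E.2, fun x y hy => ?_⟩
  have h := (le_iInf_iff.mp hH) ⟨(x, y), hy⟩
  rw [le_negLog2_iff _ _ (div_nonneg (Finset.sum_nonneg fun i _ => hP i) hy.le)] at h
  exact (div_le_iff₀ hy).mp h

/-- Min-entropy splitting: if `H^ε_∞(X₀X₁|Z) ≥ α`, then there is a binary random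
variable `C` (defined on the extension `Ω × Bool` of the probability space `Ω`, with
joint weights `P'` whose marginal on `Ω` is `P`) such that for every `ε' > 0`,
`H^{ε+ε'}_∞(X_{1-C} | Z C) ≥ α/2 - 1 - log₂(1/ε')`.  Here `C = false` encodes the bit `0`,
`C = true` the bit `1`, and `X_{1-C}` (which is `X₁` when `C = 0` and `X₀` when `C = 1`)
takes values in the sum alphabet `𝒳₀ ⊕ 𝒳₁`. -/
theorem min_entropy_splitting
    {Ω 𝒳₀ 𝒳₁ 𝒵 : Type*} [Fintype Ω] [Fintype 𝒳₀] [Fintype 𝒳₁] [Fintype 𝒵]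
    [DecidableEq 𝒳₀] [DecidableEq 𝒳₁] [DecidableEq 𝒵]
    (P : Ω → ℝ) (hP : ∀ ω, 0 ≤ P ω) (hPsum : ∑ ω, P ω = 1)
    (X₀ : Ω → 𝒳₀) (X₁ : Ω → 𝒳₁) (Z : Ω → 𝒵) (ε α : ℝ) (hε : 0 ≤ ε)
    (hH : ((α : ℝ) : EReal) ≤ smoothMinEntropyCond P (fun ω => (X₀ ω, X₁ ω)) Z ε) :
    ∃ P' : Ω × Bool → ℝ,
      (∀ p, 0 ≤ P' p) ∧
      (∀ ω : Ω, P' (ω, false) + P' (ω, true) = P ω) ∧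
      ∀ ε' : ℝ, 0 < ε' →
        (((α / 2 - 1 - Real.logb 2 (1 / ε')) : ℝ) : EReal)
          ≤ smoothMinEntropyCond P'
              (fun p : Ω × Bool =>
                if p.2 then (Sum.inl (X₀ p.1) : 𝒳₀ ⊕ 𝒳₁) else Sum.inr (X₁ p.1))
              (fun p : Ω × Bool => (Z p.1, p.2)) (ε + ε') := by
  classical
  obtain ⟨E, hEm, hE⟩ := exists_event P hP hPsum _ _ ε α hε hH
  set D : 𝒵 → ℝ := fun z => ∑ ω ∈ Finset.univ.filter (fun ω => Z ω = z), P ω with hD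
  set t : ℝ := (2 : ℝ) ^ (-(α / 2)) with ht
  have ht0 : 0 < t := by positivity
  have htt : (2 : ℝ) ^ (-α) = t * t := by
    rw [ht, ← Real.rpow_add (by norm_num)]; congr 1; ring
  set q : 𝒳₁ → 𝒵 → ℝ := fun x z =>
    ∑ ω' ∈ E.filter (fun ω' => X₁ ω' = x ∧ Z ω' = z), P ω' with hq
  set C : Ω → Bool := fun ω => decide (t * D (Z ω) ≤ q (X₁ ω) (Z ω)) with hC
  set D' : 𝒵 → Bool → ℝ := fun z c =>
    ∑ ω ∈ Finset.univ.filter (fun ω => Z ω = z ∧ C ω = c), P ω with hD'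
  have hD'D : ∀ z c, D' z c ≤ D z := fun z c =>
    Finset.sum_le_sum_of_subset_of_nonneg
      (fun ω hω => by simp only [Finset.mem_filter] at hω ⊢; tauto) (fun i _ _ => hP i)
  refine ⟨fun p => if p.2 = C p.1 then P p.1 else 0, ?_, ?_, ?_⟩
  · intro p
    dsimp only
    split_ifs
    · exact hP _
    · exact le_rfl
  · intro ω
    cases h : C ω <;> simp [h]
  intro δ hδ
  have hbad := bad_mass P hP hPsum Z C δ hδ
  set E' : Finset (Ω × Bool) := Finset.univ.filter (fun p =>
    p.1 ∈ E ∧ δ / 2 * D (Z p.1) ≤ D' (Z p.1) p.2) with hE'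
  unfold smoothMinEntropyCond
  refine le_iSup_of_le ⟨E', ?_⟩ ?_
  · rw [sum_ext_bool]
    have hsub : ∑ ω ∈ E, P ω ≤ ∑ ω ∈ Finset.univ.filter (fun ω => (ω, C ω) ∈ E'), P ω
        + ∑ ω ∈ Finset.univ.filter (fun ω => D' (Z ω) (C ω) < δ / 2 * D (Z ω)), P ω := by
      refine le_trans (Finset.sum_le_sum_of_subset_of_nonneg ?_ (fun i _ _ => hP i))
        (le_trans (le_add_of_nonneg_right
          (Finset.sum_nonneg fun i _ => hP i)) (Finset.sum_union_inter).le)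
      intro ω hω
      simp only [hE', Finset.mem_union, Finset.mem_filter, Finset.mem_univ, true_and]
      rcases le_or_gt (δ / 2 * D (Z ω)) (D' (Z ω) (C ω)) with h | h
      · exact Or.inl ⟨hω, h⟩
      · exact Or.inr h
    have hbad' : ∑ ω ∈ Finset.univ.filter
        (fun ω => D' (Z ω) (C ω) < δ / 2 * D (Z ω)), P ω ≤ δ := hbad
    linarith
  · refine le_iInf ?_
    rintro ⟨⟨x, z, c⟩, hpos⟩
    dsimp only at hpos ⊢
    have hden : ∑ p ∈ Finset.univ.filter (fun p : Ω × Bool => (Z p.1, p.2) = (z, c)),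
        (if p.2 = C p.1 then P p.1 else 0) = D' z c := by
      rw [sum_ext_bool]
      refine Finset.sum_congr (Finset.filter_congr fun ω _ => ?_) fun _ _ => rfl
      simp
    rw [hden] at hpos ⊢
    rw [sum_ext_bool]
    have hDz : 0 < D z := hpos.trans_le (hD'D z c)
    rw [le_negLog2_iff _ _ (div_nonneg (Finset.sum_nonneg fun i _ => hP i) hpos.le),
      div_le_iff₀ hpos]
    have hexp : (2 : ℝ) ^ (-(α / 2 - 1 - Real.logb 2 (1 / δ))) = t * (2 / δ) := by
      have : -(α / 2 - 1 - Real.logb 2 (1 / δ)) = -(α / 2) + 1 + Real.logb 2 (1 / δ) := by ring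
      rw [this, Real.rpow_add (by norm_num), Real.rpow_add (by norm_num),
        Real.rpow_logb (by norm_num) (by norm_num) (by positivity), Real.rpow_one]
      ring
    rw [hexp]
    by_cases hgood : δ / 2 * D z ≤ D' z c
    swap
    · rw [Finset.sum_eq_zero]
      · positivity
      · intro ω hω
        exfalso
        simp only [hE', Finset.mem_filter, Finset.mem_univ, true_and, Prod.mk.injEq] at hω
        obtain ⟨⟨_, h1⟩, _, rfl, h3⟩ := hω
        rw [h3] at h1
        exact hgood h1
    have hfin : t * D z ≤ t * (2 / δ) * D' z c := by
      have : D z ≤ 2 / δ * D' z c := by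
        rw [div_mul_eq_mul_div, le_div_iff₀ hδ]; linarith
      rw [mul_assoc]
      exact mul_le_mul_of_nonneg_left this ht0.le
    refine le_trans ?_ hfin
    have hDE : ∑ ω ∈ E.filter (fun ω => Z ω = z), P ω ≤ D z :=
      Finset.sum_le_sum_of_subset_of_nonneg
        (Finset.filter_subset_filter _ (Finset.subset_univ _)) (fun i _ _ => hP i)
    have htD : 0 ≤ t * D z := by positivity
    cases c with
    | true =>
      rcases x with x₀ | x₁
      · refine le_trans (Finset.sum_le_sum_of_subset_of_nonneg ?_ (fun i _ _ => hP i))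
          (heavy_bound P hP X₀ X₁ Z E t (D z) ht0 z x₀ hDz hDE ?_)
        · intro ω hω
          simp only [hE', Finset.mem_filter, Finset.mem_univ, true_and, Prod.mk.injEq] at hω ⊢
          obtain ⟨⟨h0, _⟩, h1, h2, h3⟩ := hω
          rw [h3] at h1
          simp only [if_true, Sum.inl.injEq] at h1
          refine ⟨h0, h1, h2, ?_⟩
          have := of_decide_eq_true h3
          rw [h2] at this
          exact this
        · intro x₁
          rw [← htt]
          exact hE _ z hDz
      · rw [Finset.sum_eq_zero]
        · exact htD
        · intro ω hω
          exfalso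
          simp only [hE', Finset.mem_filter, Finset.mem_univ, true_and, Prod.mk.injEq] at hω
          obtain ⟨_, h1, _, h3⟩ := hω
          rw [h3] at h1
          simp at h1
    | false =>
      rcases x with x₀ | x₁
      · rw [Finset.sum_eq_zero]
        · exact htD
        · intro ω hω
          exfalso
          simp only [hE', Finset.mem_filter, Finset.mem_univ, true_and, Prod.mk.injEq] at hω
          obtain ⟨_, h1, _, h3⟩ := hω
          rw [h3] at h1
          simp at h1
      · have key : ∀ ω ∈ Finset.univ.filter (fun ω => (ω, C ω) ∈ E'.filter (fun p : Ω × Bool =>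
            (if p.2 then (Sum.inl (X₀ p.1) : 𝒳₀ ⊕ 𝒳₁) else Sum.inr (X₁ p.1)) = Sum.inr x₁ ∧
              (Z p.1, p.2) = (z, false))),
            ω ∈ E ∧ X₁ ω = x₁ ∧ Z ω = z ∧ q x₁ z < t * D z := by
          intro ω hω
          simp only [hE', Finset.mem_filter, Finset.mem_univ, true_and, Prod.mk.injEq] at hω
          obtain ⟨⟨h0, _⟩, h1, h2, h3⟩ := hω
          rw [h3] at h1
          simp only [Bool.false_eq_true, if_false, Sum.inr.injEq] at h1
          have := of_decide_eq_false h3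
          rw [h1, h2, not_le] at this
          exact ⟨h0, h1, h2, this⟩
        by_cases hl : q x₁ z < t * D z
        · refine le_trans (Finset.sum_le_sum_of_subset_of_nonneg ?_ (fun i _ _ => hP i)) hl.le
          intro ω hω
          have := key ω hω
          simp only [Finset.mem_filter]
          tauto
        · rw [Finset.sum_eq_zero]
          · exact htD
          · intro ω hω
            exact absurd (key ω hω).2.2.2 hl
end

section
/- Teleported controlled-Z circuit identity: let |ψ⟩ ∈ ℂ² ⊗ ℂ² be any vector on registers (A,B), and let |Φ⟩ := (|00⟩ + |11⟩)/√2 on registers (E₁,E₂). Consider the 4-qubit state on registers ordered (A, E₁, E₂, B) obtained from |ψ⟩_{AB} ⊗ |Φ⟩_{E₁E₂} by reordering the tensor factors, and apply in sequence: a Hadamard gate on E₂; a CNOT with control E₁ and target A; and a CNOT with control E₂ and target B. Then for all h^A, h^B ∈ {0,1}, applying (⟨h^A|_A ⊗ I_{E₁} ⊗ I_{E₂} ⊗ ⟨h^B|_B) to the resulting state (i.e., projecting registers A and B onto the computational basis outcomes h^A and h^B and discarding them) yields the vector (1/2)·(−1)^{h^A h^B}·(σ_X^{h^A} σ_Z^{h^B}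 ⊗ σ_X^{h^B} σ_Z^{h^A})·CZ·|ψ⟩ on registers (E₁,E₂); in particular, up to a global phase and normalization, each measurement outcome (h^A,h^B) occurs with probability 1/4 and produces the state σ_X^{h^A}σ_Z^{h^B} ⊗ σ_X^{h^B}σ_Z^{h^A} · CZ |ψ⟩. -/
open scoped Matrix Kronecker

/-- Pauli X matrix, indexed by `Bool` (`false` = `|0⟩`, `true` = `|1⟩`). -/
def sigmaX : Matrix Bool Bool ℂ := Matrix.of fun i j => if i = j then 0 else 1

/-- Pauli Z matrix. -/
def sigmaZ : Matrix Bool Bool ℂ :=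
  Matrix.of fun i j => if i = j then (if i then -1 else 1) else 0

/-- `M^b` for a bit `b`: the matrix `M` if `b = 1`, the identity if `b = 0`. -/
def bitPow (M : Matrix Bool Bool ℂ) (b : Bool) : Matrix Bool Bool ℂ := if b then M else 1

/-- The Hadamard gate `H = (1/√2)[[1,1],[1,−1]]`. -/
noncomputable def Hgate : Matrix Bool Bool ℂ :=
  Matrix.of fun i j => ((1 / Real.sqrt 2 : ℝ) : ℂ) * (if i ∧ j then -1 else 1)

/-- The controlled-Z gate `CZ = diag(1,1,1,−1)` on two qubits. -/
def CZgate : Matrix (Bool × Bool) (Bool × Bool) ℂ :=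
  Matrix.of fun p q => if p = q then (if p.1 ∧ p.2 then -1 else 1) else 0

/-- The EPR state `|Φ⟩ = (|00⟩ + |11⟩)/√2`. -/
noncomputable def bell00 : Bool × Bool → ℂ :=
  fun p => if p.1 = p.2 then ((1 / Real.sqrt 2 : ℝ) : ℂ) else 0

/-- The initial 4-qubit state `|ψ⟩_{AB} ⊗ |Φ⟩_{E₁E₂}`, with registers ordered
`(A, E₁, E₂, B)`; the component at basis index `(a, e₁, e₂, b)` is `ψ(a,b)·Φ(e₁,e₂)`. -/
noncomputable def initState (ψ : Bool × Bool → ℂ) : Bool × Bool × Bool × Bool → ℂ :=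
  fun r => ψ (r.1, r.2.2.2) * bell00 (r.2.1, r.2.2.1)

/-- Apply a Hadamard gate on register `E₂` of a 4-qubit state on `(A, E₁, E₂, B)`. -/
noncomputable def applyH_E2 (v : Bool × Bool × Bool × Bool → ℂ) :
    Bool × Bool × Bool × Bool → ℂ :=
  fun r => ∑ e2' : Bool, Hgate r.2.2.1 e2' * v (r.1, r.2.1, e2', r.2.2.2)

/-- Apply a CNOT with control `E₁` and target `A` (`|c⟩_C |t⟩_T ↦ |c⟩_C |t ⊕ c⟩_T`). -/
def applyCNOT_E1_A (v : Bool × Bool × Bool × Bool → ℂ) :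
    Bool × Bool × Bool × Bool → ℂ :=
  fun r => v (xor r.1 r.2.1, r.2.1, r.2.2.1, r.2.2.2)

/-- Apply a CNOT with control `E₂` and target `B`. -/
def applyCNOT_E2_B (v : Bool × Bool × Bool × Bool → ℂ) :
    Bool × Bool × Bool × Bool → ℂ :=
  fun r => v (r.1, r.2.1, r.2.2.1, xor r.2.2.2 r.2.2.1)

/-- Teleported controlled-Z circuit identity: starting from `|ψ⟩_{AB} ⊗ |Φ⟩_{E₁E₂}` on
registers `(A, E₁, E₂, B)`, apply a Hadamard on `E₂`, a CNOT with control `E₁` and target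
`A`, and a CNOT with control `E₂` and target `B`; then projecting registers `A` and `B`
onto the computational-basis outcomes `h^A` and `h^B` leaves on `(E₁, E₂)` the vector
`(1/2)·(−1)^{h^A h^B}·(σ_X^{h^A} σ_Z^{h^B} ⊗ σ_X^{h^B} σ_Z^{h^A})·CZ·|ψ⟩`. -/
theorem teleported_CZ_circuit (ψ : Bool × Bool → ℂ) (hA hB : Bool) :
    (fun p : Bool × Bool =>
        applyCNOT_E2_B (applyCNOT_E1_A (applyH_E2 (initState ψ))) (hA, p.1, p.2, hB))
      = ((1 / 2 : ℂ) * (if hA ∧ hB then -1 else 1)) •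
          ((((bitPow sigmaX hA * bitPow sigmaZ hB) ⊗ₖ
              (bitPow sigmaX hB * bitPow sigmaZ hA)) * CZgate) *ᵥ ψ) := by
  have h2 : ((1 / Real.sqrt 2 : ℝ) : ℂ) * ((1 / Real.sqrt 2 : ℝ) : ℂ) = 1 / 2 := by
    rw [← Complex.ofReal_mul, div_mul_div_comm, Real.mul_self_sqrt (by norm_num)]
    norm_num
  funext p
  obtain ⟨e1, e2⟩ := p
  simp only [applyCNOT_E2_B, applyCNOT_E1_A, applyH_E2, initState, bell00, Hgate, Matrix.of_apply,
    Pi.smul_apply, smul_eq_mul]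
  generalize ((1 / Real.sqrt 2 : ℝ) : ℂ) = s at h2
  cases hA <;> cases hB <;> cases e1 <;> cases e2 <;>
    simp [Matrix.mulVec, dotProduct, Matrix.mul_apply, Fintype.sum_prod_type, bitPow, sigmaX,
      sigmaZ, CZgate, Matrix.one_apply] <;>
    linear_combination (exp := 1) (ψ _) * h2
end
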